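/- Suppose fₙ and f are absolutely continuous functions on [α, β] with fₙ(α) → f(α), ‖fₙ′ − f′‖_{L¹([α,β])} → 0, and f′(x) ≠ 0 for almost all x ∈ [α, β]. Then the image measures λ_{[α,β]} fₙ^{−1} converge in total variation to λ_{[α,β]} f^{−1} as n → ∞. -/

import Mathlib

open MeasureTheory Filter intervalIntegral
open scoped ENNReal

/-- Total variation distance between two finite measures. -/
noncomputable def tvDist {α : Type*} [MeasurableSpace α] (μ ν : Measure α)
    [IsFiniteMeasure μ] [IsFiniteMeasure ν] : ℝ≥0∞ :=
  (μ.toSignedMeasure - ν.toSignedMeasure).totalVariation Set.univ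

lemma ac_comp_lip (F Φ : ℝ → ℝ) (a b : ℝ) (hF : AbsolutelyContinuousOnInterval F a b)
    (hΦ : ∀ x y, |Φ x - Φ y| ≤ |x - y|) :
    AbsolutelyContinuousOnInterval (fun x => Φ (F x)) a b := by
  unfold AbsolutelyContinuousOnInterval at hF ⊢
  refine squeeze_zero (fun _ => Finset.sum_nonneg (fun i hi => dist_nonneg)) (fun E => ?_) hF
  refine Finset.sum_le_sum fun i _ => ?_
  simpa [Real.dist_eq] using hΦ _ _

lemma prim_lip (φ : ℝ → ℝ) (hφ : Continuous φ) (hφ1 : ∀ y, |φ y| ≤ 1) (x y : ℝ) :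
    |(∫ t in (0:ℝ)..x, φ t) - ∫ t in (0:ℝ)..y, φ t| ≤ |x - y| := by
  rw [intervalIntegral.integral_interval_sub_left (hφ.intervalIntegrable _ _)
    (hφ.intervalIntegrable _ _)]
  simpa using intervalIntegral.norm_integral_le_of_norm_le_const (a := y) (b := x) (f := φ) (C := 1)
    (fun t _ => by simpa using hφ1 t)

lemma ac_prim (a b c : ℝ) (u : ℝ → ℝ) (hu : IntervalIntegrable u volume a b) :
    AbsolutelyContinuousOnInterval (fun x => c + ∫ t in a..x, u t) a b := by
  have h1 := hu.absolutelyContinuousOnInterval_intervalIntegral (c := a) (by simp)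
  have h2 : AbsolutelyContinuousOnInterval (fun _ : ℝ => c) a b :=
    (LipschitzWith.const c).lipschitzOnWith.absolutelyContinuousOnInterval
  exact h2.add h1

lemma ibp (a b c : ℝ) (u : ℝ → ℝ) (hu : IntervalIntegrable u volume a b)
    (φ : ℝ → ℝ) (hφ : Continuous φ) (hφ1 : ∀ y, |φ y| ≤ 1) (g : ℝ → ℝ) (hg : ContDiff ℝ 1 g)
    (F Φ : ℝ → ℝ) (hF : F = fun x => c + ∫ t in a..x, u t)
    (hΦ : Φ = fun y => ∫ t in (0:ℝ)..y, φ t) :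
    ∫ x in a..b, φ (F x) * u x * g x
      = Φ (F b) * g b - Φ (F a) * g a - ∫ x in a..b, Φ (F x) * deriv g x := by
  have hFac : AbsolutelyContinuousOnInterval F a b := hF ▸ ac_prim a b c u hu
  have hC : AbsolutelyContinuousOnInterval (fun x => Φ (F x)) a b :=
    ac_comp_lip F Φ a b hFac (by subst hΦ; exact prim_lip φ hφ hφ1)
  have hgac : AbsolutelyContinuousOnInterval g a b :=
    hg.contDiffOn.absolutelyContinuousOnInterval
  have := hC.integral_mul_deriv_eq_deriv_mul hgac
  rw [this, sub_sub_cancel]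
  apply intervalIntegral.integral_congr_ae
  filter_upwards [hu.ae_hasDerivAt_integral] with x hx hx3
  have h1 := (hx (Set.uIoc_subset_uIcc hx3) a (by simp)).const_add c
  have h2 : HasDerivAt Φ (φ (F x)) (F x) := by
    subst hΦ; exact (hφ.integral_hasStrictDerivAt 0 (F x)).hasDerivAt
  have h1' : HasDerivAt F (u x) x := by rw [hF]; exact h1
  have h3 := h2.comp x h1'
  rw [show deriv (fun x => Φ (F x)) x = φ (F x) * u x from h3.deriv]

lemma dist_prim (a b c d : ℝ) (u v : ℝ → ℝ)
    (hu : IntervalIntegrable u volume a b) (hv : IntervalIntegrable v volume a b)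
    (x : ℝ) (hx : x ∈ Set.Icc a b) :
    |(c + ∫ t in a..x, u t) - (d + ∫ t in a..x, v t)| ≤ |c - d| + ∫ t in a..b, |u t - v t| := by
  have hab : a ≤ b := hx.1.trans hx.2
  have hs : Set.uIcc a x ⊆ Set.uIcc a b := by
    rw [Set.uIcc_of_le hx.1, Set.uIcc_of_le hab]; exact Set.Icc_subset_Icc le_rfl hx.2
  have h1 : (c + ∫ t in a..x, u t) - (d + ∫ t in a..x, v t) =
      (c - d) + ∫ t in a..x, (u t - v t) := by
    rw [intervalIntegral.integral_sub (hu.mono_set hs) (hv.mono_set hs)]; ring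
  rw [h1]
  refine (abs_add_le _ _).trans (add_le_add le_rfl ?_)
  refine (intervalIntegral.abs_integral_le_integral_abs hx.1).trans ?_
  exact intervalIntegral.integral_mono_interval le_rfl hx.1 hx.2
    (Eventually.of_forall fun t => abs_nonneg _) (hu.sub hv).abs

lemma key_bound (a b : ℝ) (hab : a ≤ b) (v g : ℝ → ℝ) (hg : ContDiff ℝ 1 g)
    (hv : IntervalIntegrable v volume a b) :
    ∃ C : ℝ, 0 ≤ C ∧ ∀ (c d : ℝ) (u : ℝ → ℝ), IntervalIntegrable u volume a b →
      ∀ φ : ℝ → ℝ, Continuous φ → (∀ y, |φ y| ≤ 1) →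
      |∫ x in a..b, (φ (c + ∫ t in a..x, u t) - φ (d + ∫ t in a..x, v t)) * v x * g x| ≤
        C * (|c - d| + ∫ t in a..b, |u t - v t|) := by
  obtain ⟨G, hG⟩ := isCompact_Icc.exists_bound_of_continuousOn (s := Set.Icc a b)
    hg.continuous.continuousOn
  have hg' : Continuous (deriv g) := hg.continuous_deriv le_rfl
  obtain ⟨G', hG'⟩ := isCompact_Icc.exists_bound_of_continuousOn (s := Set.Icc a b)
    hg'.continuousOn
  have ha : a ∈ Set.Icc a b := ⟨le_rfl, hab⟩
  have hb : b ∈ Set.Icc a b := ⟨hab, le_rfl⟩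
  have hG0 : 0 ≤ G := (norm_nonneg _).trans (hG a ha)
  have hG'0 : 0 ≤ G' := (norm_nonneg _).trans (hG' a ha)
  have hba : 0 ≤ b - a := sub_nonneg.2 hab
  refine ⟨G + G + G' * (b - a) + G, by positivity, ?_⟩
  intro c d u hu φ hφ hφ1
  set D := |c - d| + ∫ t in a..b, |u t - v t| with hD
  set F : ℝ → ℝ := fun x => c + ∫ t in a..x, u t with hF
  set H : ℝ → ℝ := fun x => d + ∫ t in a..x, v t with hH
  set Φ : ℝ → ℝ := fun y => ∫ t in (0:ℝ)..y, φ t with hΦ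
  have hFc : ContinuousOn F (Set.uIcc a b) := (ac_prim a b c u hu).continuousOn
  have hHc : ContinuousOn H (Set.uIcc a b) := (ac_prim a b d v hv).continuousOn
  have hFH : ∀ x ∈ Set.Icc a b, |F x - H x| ≤ D := fun x hx => dist_prim a b c d u v hu hv x hx
  have hΦl : ∀ x ∈ Set.Icc a b, |Φ (F x) - Φ (H x)| ≤ D := fun x hx =>
    (prim_lip φ hφ hφ1 _ _).trans (hFH x hx)
  have hD0 : 0 ≤ D := (abs_nonneg _).trans (hFH a ha)
  have hint0 : 0 ≤ ∫ t in a..b, |u t - v t| :=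
    intervalIntegral.integral_nonneg hab fun t _ => abs_nonneg _
  have hintD : ∫ t in a..b, |u t - v t| ≤ D := by
    rw [hD]; linarith [abs_nonneg (c - d)]
  have e1 := ibp a b c u hu φ hφ hφ1 g hg F Φ hF hΦ
  have e2 := ibp a b d v hv φ hφ hφ1 g hg H Φ hH hΦ
  have hφF : ContinuousOn (fun x => φ (F x)) (Set.uIcc a b) := hφ.comp_continuousOn hFc
  have hφH : ContinuousOn (fun x => φ (H x)) (Set.uIcc a b) := hφ.comp_continuousOn hHc
  have hΦc : Continuous Φ := by
    rw [hΦ]; exact intervalIntegral.continuous_primitive (fun _ _ => hφ.intervalIntegrable _ _) 0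
  have hgc : ContinuousOn g (Set.uIcc a b) := hg.continuous.continuousOn
  have i1 : IntervalIntegrable (fun x => φ (F x) * u x * g x) volume a b :=
    (hu.continuousOn_mul hφF).mul_continuousOn hgc
  have i2 : IntervalIntegrable (fun x => φ (H x) * v x * g x) volume a b :=
    (hv.continuousOn_mul hφH).mul_continuousOn hgc
  have i3 : IntervalIntegrable (fun x => φ (F x) * (u x - v x) * g x) volume a b :=
    ((hu.sub hv).continuousOn_mul hφF).mul_continuousOn hgc
  have j1 : IntervalIntegrable (fun x => Φ (F x) * deriv g x) volume a b :=
    ((hΦc.comp_continuousOn hFc).mul hg'.continuousOn).intervalIntegrable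
  have j2 : IntervalIntegrable (fun x => Φ (H x) * deriv g x) volume a b :=
    ((hΦc.comp_continuousOn hHc).mul hg'.continuousOn).intervalIntegrable
  have split : ∫ x in a..b, (φ (F x) - φ (H x)) * v x * g x =
      (Φ (F b) - Φ (H b)) * g b - (Φ (F a) - Φ (H a)) * g a
        - (∫ x in a..b, (Φ (F x) - Φ (H x)) * deriv g x)
        - ∫ x in a..b, φ (F x) * (u x - v x) * g x := by
    have s1 : ∫ x in a..b, (φ (F x) - φ (H x)) * v x * g x =
        ((∫ x in a..b, φ (F x) * u x * g x) - ∫ x in a..b, φ (H x) * v x * g x)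
          - ∫ x in a..b, φ (F x) * (u x - v x) * g x := by
      rw [← intervalIntegral.integral_sub i1 i2, ← intervalIntegral.integral_sub (i1.sub i2) i3]
      congr 1; ext x; ring
    have s2 : ∫ x in a..b, (Φ (F x) - Φ (H x)) * deriv g x =
        (∫ x in a..b, Φ (F x) * deriv g x) - ∫ x in a..b, Φ (H x) * deriv g x := by
      rw [← intervalIntegral.integral_sub j1 j2]
      congr 1; ext x; ring
    rw [s1, s2, e1, e2]; ring
  have b1 : |(Φ (F b) - Φ (H b)) * g b| ≤ D * G := by
    rw [abs_mul]; exact mul_le_mul (hΦl b hb) (hG b hb) (abs_nonneg _) hD0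
  have b2 : |(Φ (F a) - Φ (H a)) * g a| ≤ D * G := by
    rw [abs_mul]; exact mul_le_mul (hΦl a ha) (hG a ha) (abs_nonneg _) hD0
  have b3 : |∫ x in a..b, (Φ (F x) - Φ (H x)) * deriv g x| ≤ D * G' * (b - a) := by
    have := intervalIntegral.norm_integral_le_of_norm_le_const (a := a) (b := b)
      (f := fun x => (Φ (F x) - Φ (H x)) * deriv g x) (C := D * G') (fun x hx => by
        have hx' : x ∈ Set.Icc a b := by
          rw [Set.uIoc_of_le hab] at hx; exact Set.Ioc_subset_Icc_self hx
        rw [norm_mul]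
        exact mul_le_mul (hΦl x hx') (hG' x hx') (norm_nonneg _) hD0)
    rwa [abs_of_nonneg hba] at this
  have b4 : |∫ x in a..b, φ (F x) * (u x - v x) * g x| ≤ G * D := by
    refine (intervalIntegral.abs_integral_le_integral_abs hab).trans ?_
    calc _ ≤ ∫ x in a..b, G * |u x - v x| := by
          refine intervalIntegral.integral_mono_on hab i3.abs ((hu.sub hv).abs.const_mul G) ?_
          intro x hx
          rw [abs_mul, abs_mul]
          have h1 := hφ1 (F x)
          have h2 : |g x| ≤ G := hG x hx
          calc |φ (F x)| * |u x - v x| * |g x| ≤ 1 * |u x - v x| * G := by gcongr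
            _ = _ := by ring
      _ = G * ∫ x in a..b, |u x - v x| := by rw [intervalIntegral.integral_const_mul]
      _ ≤ G * D := by gcongr
  rw [split]
  rw [abs_le] at *
  constructor <;> nlinarith

lemma approx_one (a b : ℝ) (hab : a ≤ b) (v : ℝ → ℝ)
    (hv : IntegrableOn v (Set.Icc a b) volume)
    (hne : ∀ᵐ x ∂volume.restrict (Set.Icc a b), v x ≠ 0) (ε : ℝ) (hε : 0 < ε) :
    ∃ g : ℝ → ℝ, ContDiff ℝ 1 g ∧ ∫ x in Set.Icc a b, |1 - v x * g x| ≤ ε := by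
  set μ := volume.restrict (Set.Icc a b) with hμ
  have hvm : AEMeasurable (fun x => ‖v x‖₊) μ := hv.1.aemeasurable.nnnorm
  set ν := μ.withDensity (fun x => (‖v x‖₊ : ℝ≥0∞)) with hν
  have : IsFiniteMeasure ν := isFiniteMeasure_withDensity hv.2.ne
  have h1 : Integrable (fun x => (v x)⁻¹) ν := by
    rw [hν, integrable_withDensity_iff_integrable_coe_smul₀ hvm]
    refine Integrable.mono' (integrable_const (1:ℝ)) ?_ ?_
    · exact (hv.1.norm.aemeasurable.mul hv.1.aemeasurable.inv).aestronglyMeasurable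
    · filter_upwards [hne] with x hx
      simp [hx]
  obtain ⟨g1, -, hg1, hg1c, hg1i⟩ := h1.exists_hasCompactSupport_integral_sub_le (half_pos hε)
  rw [hν, integral_withDensity_eq_integral_smul₀ hvm] at hg1
  set L := ∫ x, |v x| ∂μ with hL
  have hL0 : 0 ≤ L := integral_nonneg fun _ => abs_nonneg _
  obtain ⟨p, hp⟩ := exists_polynomial_near_of_continuousOn a b g1 hg1c.continuousOn
    (ε / 2 / (L + 1)) (by positivity)
  refine ⟨fun x => p.eval x, by simpa using p.contDiff_aeval (𝕜 := ℝ) 1, ?_⟩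
  have hmem : ∀ᵐ x ∂μ, x ∈ Set.Icc a b := ae_restrict_mem measurableSet_Icc
  have hvg : ∀ k : ℝ → ℝ, Continuous k → Integrable (fun x => v x * k x) μ := fun k hk =>
    IntegrableOn.mul_continuousOn hv hk.continuousOn isCompact_Icc
  have i1 : Integrable (fun x => |1 - v x * g1 x|) μ :=
    ((integrable_const 1).sub (hvg _ hg1c)).abs
  have i0 : Integrable (fun x => |1 - v x * p.eval x|) μ :=
    ((integrable_const 1).sub (hvg _ p.continuous)).abs
  have i2 : Integrable (fun x => (ε / 2 / (L + 1)) * |v x|) μ := hv.abs.const_mul _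
  calc ∫ x, |1 - v x * p.eval x| ∂μ
      ≤ ∫ x, (|1 - v x * g1 x| + (ε / 2 / (L + 1)) * |v x|) ∂μ := by
        refine integral_mono_ae i0 (i1.add i2) ?_
        filter_upwards [hmem] with x hx
        have h3 : |v x * (g1 x - p.eval x)| ≤ (ε / 2 / (L + 1)) * |v x| := by
          rw [abs_mul, mul_comm, abs_sub_comm]
          exact mul_le_mul_of_nonneg_right (hp x hx).le (abs_nonneg _)
        calc |1 - v x * p.eval x| = |(1 - v x * g1 x) + v x * (g1 x - p.eval x)| := by
              congr 1; ring
          _ ≤ _ := (abs_add_le _ _).trans (by simpa using h3)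
    _ = (∫ x, |1 - v x * g1 x| ∂μ) + (ε / 2 / (L + 1)) * L := by
        rw [integral_add i1 i2, MeasureTheory.integral_const_mul]
    _ ≤ ε / 2 + ε / 2 := by
        refine add_le_add ?_ ?_
        · refine le_trans (le_of_eq ?_) hg1
          refine integral_congr_ae ?_
          filter_upwards [hne] with x hx
          show |1 - v x * g1 x| = ‖v x‖ * ‖(v x)⁻¹ - g1 x‖
          rw [← norm_mul, mul_sub, mul_inv_cancel₀ hx, Real.norm_eq_abs]
        · rw [div_mul_eq_mul_div, div_le_iff₀ (by positivity)]
          nlinarith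
    _ = ε := by ring

lemma tv_le (μ ν : Measure ℝ) [IsFiniteMeasure μ] [IsFiniteMeasure ν] (K : ℝ)
    (h : ∀ φ : ℝ → ℝ, Continuous φ → (∀ y, |φ y| ≤ 1) → |∫ y, φ y ∂μ - ∫ y, φ y ∂ν| ≤ K) :
    tvDist μ ν ≤ ENNReal.ofReal (2 * K) := by
  have hK : 0 ≤ K := (abs_nonneg _).trans (h 0 continuous_const (by simp))
  have hset : ∀ A, MeasurableSet A → |μ.real A - ν.real A| ≤ K := by
    intro A hA
    refine le_of_forall_pos_le_add fun ε hε => ?_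
    have hi : Integrable (A.indicator (fun _ => (1:ℝ))) (μ + ν) :=
      (integrable_const 1).indicator hA
    obtain ⟨g, hg, hgi⟩ := hi.exists_boundedContinuous_integral_sub_le hε
    set φ : ℝ → ℝ := fun y => max 0 (min 1 (g y)) with hφ
    have hφc : Continuous φ := by fun_prop
    have hφ1 : ∀ y, |φ y| ≤ 1 := by
      intro y
      rw [abs_of_nonneg (le_max_left _ _)]
      exact max_le zero_le_one (min_le_left _ _)
    have hφi : ∀ ρ : Measure ℝ, IsFiniteMeasure ρ → Integrable φ ρ := fun ρ _ =>
      Integrable.mono' (integrable_const (1:ℝ)) hφc.aestronglyMeasurable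
        (Eventually.of_forall hφ1)
    have hAi : ∀ ρ : Measure ℝ, IsFiniteMeasure ρ → Integrable (A.indicator (fun _ => (1:ℝ))) ρ :=
      fun ρ _ => (integrable_const 1).indicator hA
    have hle : ∫ y, |A.indicator (fun _ => (1:ℝ)) y - φ y| ∂(μ + ν) ≤ ε := by
      refine le_trans (integral_mono ((hi.sub (hφi _ inferInstance)).abs)
        (hi.sub hgi).norm fun y => ?_) hg
      show |A.indicator (fun _ => (1:ℝ)) y - φ y| ≤ |A.indicator (fun _ => (1:ℝ)) y - g y|
      have : A.indicator (fun _ => (1:ℝ)) y = max 0 (min 1 (A.indicator (fun _ => (1:ℝ)) y)) := by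
        by_cases hy : y ∈ A <;> simp [hy]
      rw [this, hφ]
      simp only
      refine (abs_max_sub_max_le_max _ _ _ _).trans ?_
      simp only [sub_self, abs_zero]
      refine max_le (abs_nonneg _) ?_
      refine (abs_min_sub_min_le_max _ _ _ _).trans ?_
      rw [← this]
      simp
    have hind : ∀ ρ : Measure ℝ, IsFiniteMeasure ρ →
        |ρ.real A - ∫ y, φ y ∂ρ| ≤ ∫ y, |A.indicator (fun _ => (1:ℝ)) y - φ y| ∂ρ := by
      intro ρ hρ
      have : ρ.real A = ∫ y, A.indicator (fun _ => (1:ℝ)) y ∂ρ := by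
        rw [MeasureTheory.integral_indicator hA]; simp
      rw [this, ← integral_sub (hAi ρ hρ) (hφi ρ hρ)]
      exact abs_integral_le_integral_abs
    have habs : ∀ ρ : Measure ℝ, IsFiniteMeasure ρ →
        Integrable (fun y => |A.indicator (fun _ => (1:ℝ)) y - φ y|) ρ := fun ρ hρ =>
      ((hAi ρ hρ).sub (hφi ρ hρ)).abs
    rw [integral_add_measure (habs μ inferInstance) (habs ν inferInstance)] at hle
    have h1 := hind μ inferInstance
    have h2 := hind ν inferInstance
    have h3 := h φ hφc hφ1
    rw [abs_le] at h1 h2 h3 ⊢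
    constructor <;> linarith
  obtain ⟨i, hi₁, hi₂, hi₃, hp, hn⟩ :=
    (μ.toSignedMeasure - ν.toSignedMeasure).toJordanDecomposition_spec
  rw [tvDist, SignedMeasure.totalVariation, Measure.add_apply, hp, hn,
    SignedMeasure.toMeasureOfZeroLE_apply _ _ _ MeasurableSet.univ,
    SignedMeasure.toMeasureOfLEZero_apply _ _ _ MeasurableSet.univ, two_mul,
    ENNReal.ofReal_add hK hK]
  refine add_le_add ?_ ?_
  · rw [ENNReal.ofReal, ENNReal.coe_le_coe, ← NNReal.coe_le_coe, Real.coe_toNNReal _ hK]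
    show (μ.toSignedMeasure - ν.toSignedMeasure) (i ∩ Set.univ) ≤ K
    rw [Set.inter_univ, Measure.toSignedMeasure_sub_apply hi₁]
    exact (abs_le.1 (hset i hi₁)).2
  · rw [ENNReal.ofReal, ENNReal.coe_le_coe, ← NNReal.coe_le_coe, Real.coe_toNNReal _ hK]
    show -(μ.toSignedMeasure - ν.toSignedMeasure) (iᶜ ∩ Set.univ) ≤ K
    rw [Set.inter_univ, Measure.toSignedMeasure_sub_apply hi₁.compl]
    linarith [(abs_le.1 (hset _ hi₁.compl)).1]

/-- Davydov's lemma: if `fₙ`, `f` are absolutely continuous on `[α, β]` (i.e. they are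
integrals of their integrable derivatives `fₙ'`, `f'`), with `fₙ(α) → f(α)`,
`fₙ' → f'` in `L¹([α,β])` and `f' ≠ 0` a.e. on `[α,β]`, then the image measures
`λ_{[α,β]} fₙ⁻¹` converge in total variation to `λ_{[α,β]} f⁻¹`. -/
theorem tendsto_tvDist_map_of_absolutelyContinuous (a b : ℝ) (hab : a ≤ b)
    (fn : ℕ → ℝ → ℝ) (f : ℝ → ℝ) (fn' : ℕ → ℝ → ℝ) (f' : ℝ → ℝ)
    (hfn'int : ∀ n, IntegrableOn (fn' n) (Set.Icc a b) volume)
    (hf'int : IntegrableOn f' (Set.Icc a b) volume)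
    (hfnAC : ∀ n, ∀ x ∈ Set.Icc a b, fn n x = fn n a + ∫ t in a..x, fn' n t)
    (hfAC : ∀ x ∈ Set.Icc a b, f x = f a + ∫ t in a..x, f' t)
    (hinit : Tendsto (fun n => fn n a) atTop (nhds (f a)))
    (hL1 : Tendsto (fun n => ∫ x in Set.Icc a b, |fn' n x - f' x|) atTop (nhds 0))
    (hf'ne : ∀ᵐ x ∂volume.restrict (Set.Icc a b), f' x ≠ 0) :
    Tendsto
      (fun n => tvDist ((volume.restrict (Set.Icc a b)).map (fn n))
        ((volume.restrict (Set.Icc a b)).map f))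
      atTop (nhds 0) := by
  have hI : ∀ u : ℝ → ℝ, IntegrableOn u (Set.Icc a b) volume → IntervalIntegrable u volume a b :=
    fun u hu => (intervalIntegrable_iff_integrableOn_Icc_of_le hab).2 hu
  have hfi := hI _ hf'int
  have hmem : ∀ᵐ x ∂volume.restrict (Set.Icc a b), x ∈ Set.Icc a b :=
    ae_restrict_mem measurableSet_Icc
  have hcont : ∀ (h : ℝ → ℝ) (u : ℝ → ℝ), IntegrableOn u (Set.Icc a b) volume →
      (∀ x ∈ Set.Icc a b, h x = h a + ∫ t in a..x, u t) →
      AEMeasurable h (volume.restrict (Set.Icc a b)) := by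
    intro h u hu hh
    have hc : ContinuousOn (fun x => h a + ∫ t in a..x, u t) (Set.Icc a b) := by
      rw [← Set.uIcc_of_le hab]
      exact (ac_prim a b (h a) u (hI u hu)).continuousOn
    exact (hc.congr hh).aemeasurable measurableSet_Icc
  set D : ℕ → ℝ := fun n => |fn n a - f a| + ∫ x in Set.Icc a b, |fn' n x - f' x| with hD
  have hDt : Tendsto D atTop (nhds 0) := by
    have h1 : Tendsto (fun n => |fn n a - f a|) atTop (nhds 0) := by
      simpa using (hinit.sub_const (f a)).abs
    simpa using h1.add hL1
  have hcv : ∀ k : ℝ → ℝ, ∫ x in Set.Icc a b, k x = ∫ x in a..b, k x := fun k => by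
    rw [intervalIntegral.integral_of_le hab, integral_Icc_eq_integral_Ioc]
  have main : ∀ ε : ℝ, 0 < ε → ∃ C : ℝ, 0 ≤ C ∧ ∀ n,
      tvDist ((volume.restrict (Set.Icc a b)).map (fn n))
        ((volume.restrict (Set.Icc a b)).map f) ≤ ENNReal.ofReal (2 * (C * D n + 2 * ε)) := by
    intro ε hε
    obtain ⟨g, hg, hgε⟩ := approx_one a b hab f' hf'int hf'ne ε hε
    obtain ⟨C, hC0, hC⟩ := key_bound a b hab f' g hg hfi
    refine ⟨C, hC0, fun n => tv_le _ _ _ fun φ hφ hφ1 => ?_⟩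
    have hmn := hcont (fn n) (fn' n) (hfn'int n) (hfnAC n)
    have hm := hcont f f' hf'int hfAC
    rw [integral_map hmn hφ.aestronglyMeasurable, integral_map hm hφ.aestronglyMeasurable]
    have ib : ∀ h : ℝ → ℝ, AEMeasurable h (volume.restrict (Set.Icc a b)) →
        Integrable (fun x => φ (h x)) (volume.restrict (Set.Icc a b)) := fun h hh =>
      Integrable.mono' (integrable_const (1:ℝ))
        (hφ.measurable.comp_aemeasurable hh).aestronglyMeasurable
        (Eventually.of_forall fun x => hφ1 (h x))
    have idiff : Integrable (fun x => φ (fn n x) - φ (f x)) (volume.restrict (Set.Icc a b)) :=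
      (ib _ hmn).sub (ib _ hm)
    have bd : ∀ x, |φ (fn n x) - φ (f x)| ≤ 2 := fun x => by
      have h1 := abs_le.1 (hφ1 (fn n x))
      have h2 := abs_le.1 (hφ1 (f x))
      rw [abs_le]; constructor <;> linarith
    have ivg : Integrable (fun x => f' x * g x) (volume.restrict (Set.Icc a b)) :=
      IntegrableOn.mul_continuousOn hf'int hg.continuous.continuousOn isCompact_Icc
    have i1 : Integrable (fun x => (φ (fn n x) - φ (f x)) * (f' x * g x))
        (volume.restrict (Set.Icc a b)) :=
      ivg.bdd_mul (c := 2) idiff.1 (Eventually.of_forall bd)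
    have i2 : Integrable (fun x => (φ (fn n x) - φ (f x)) * (1 - f' x * g x))
        (volume.restrict (Set.Icc a b)) :=
      ((integrable_const 1).sub ivg).bdd_mul (c := 2) idiff.1 (Eventually.of_forall bd)
    rw [← integral_sub (ib _ hmn) (ib _ hm)]
    have e : ∫ x in Set.Icc a b, (φ (fn n x) - φ (f x)) =
        (∫ x in Set.Icc a b, (φ (fn n x) - φ (f x)) * (f' x * g x)) +
        ∫ x in Set.Icc a b, (φ (fn n x) - φ (f x)) * (1 - f' x * g x) := by
      rw [← integral_add i1 i2]; congr 1; ext x; ring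
    rw [e]
    refine (abs_add_le _ _).trans (add_le_add ?_ ?_)
    · have := hC (fn n a) (f a) (fn' n) (hI _ (hfn'int n)) φ hφ hφ1
      rw [← hcv, ← hcv] at this
      refine le_trans (le_of_eq ?_) this
      congr 1
      refine integral_congr_ae ?_
      filter_upwards [hmem] with x hx
      rw [← hfnAC n x hx, ← hfAC x hx, mul_assoc]
    · refine abs_integral_le_integral_abs.trans ?_
      calc _ ≤ ∫ x in Set.Icc a b, 2 * |1 - f' x * g x| := by
            refine integral_mono i2.abs (((integrable_const 1).sub ivg).abs.const_mul 2) ?_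
            intro x
            show |(φ (fn n x) - φ (f x)) * (1 - f' x * g x)| ≤ 2 * |1 - f' x * g x|
            rw [abs_mul]
            exact mul_le_mul_of_nonneg_right (bd x) (abs_nonneg _)
        _ ≤ 2 * ε := by rw [MeasureTheory.integral_const_mul]; linarith
  rw [ENNReal.tendsto_nhds_zero]
  intro η hη
  obtain ⟨δ, hδ0, hδ⟩ : ∃ δ : ℝ, 0 < δ ∧ ENNReal.ofReal δ ≤ η := by
    by_cases ht : η = ⊤
    · exact ⟨1, one_pos, by simp [ht]⟩
    · exact ⟨η.toReal, ENNReal.toReal_pos hη.ne' ht, by rw [ENNReal.ofReal_toReal ht]⟩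
  obtain ⟨C, hC0, hC⟩ := main (δ / 8) (by positivity)
  have ht : Tendsto (fun n => C * D n) atTop (nhds 0) := by simpa using hDt.const_mul C
  filter_upwards [ht.eventually (gt_mem_nhds (show (0:ℝ) < δ / 4 by positivity))] with n hn
  refine (hC n).trans (le_trans (ENNReal.ofReal_le_ofReal ?_) hδ)
  linarith
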